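/- arXiv:0908.2151 — 5 statements merged into one kernel-verified Lean document; each statement's English description precedes it below -/
import Mathlib

section
/- Let G = (V,E) be a finite simple graph and let β : E → ℝ satisfy β(e) ≥ 0 for all e ∈ E. Then Z_spins(β) = 2^{|V|} · (∏_{e ∈ E} cosh β(e)) · Z_subs(λ), where λ(e) = tanh β(e) for every edge e. -/
open Finset

variable {V : Type*} [Fintype V] [DecidableEq V]

/-- An edge subset is *even* if every vertex has even degree in it. -/
def IsEvenSubgraph (y : Finset (Sym2 V)) : Prop :=
  ∀ i : V, Even ((y.filter (fun e => i ∈ e)).card)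

instance (y : Finset (Sym2 V)) : Decidable (IsEvenSubgraph y) :=
  inferInstanceAs (Decidable (∀ i : V, Even ((y.filter (fun e => i ∈ e)).card)))

/-- Number of connected components of the graph `(V, z)` (isolated vertices count). -/
noncomputable def numComponents (z : Finset (Sym2 V)) : ℕ :=
  Nat.card (SimpleGraph.fromEdgeSet (z : Set (Sym2 V))).ConnectedComponent

/-- The product `x i * x j` of the two spins at the endpoints of an edge, as a real number. -/
def edgeSpinProd (x : V → ℤˣ) : Sym2 V → ℝ :=
  Sym2.lift ⟨fun i j => ((x i : ℤ) : ℝ) * ((x j : ℤ) : ℝ), fun i j => by ring⟩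

/-- Spins partition function. -/
noncomputable def Zspins (G : SimpleGraph V) [DecidableRel G.Adj] (β : Sym2 V → ℝ) : ℝ :=
  ∑ x : V → ℤˣ, ∏ e ∈ G.edgeFinset, Real.exp (β e * edgeSpinProd x e)

/-- Subgraphs-world partition function. -/
noncomputable def Zsubs (G : SimpleGraph V) [DecidableRel G.Adj] (lam : Sym2 V → ℝ) : ℝ :=
  ∑ y ∈ G.edgeFinset.powerset.filter (fun y => IsEvenSubgraph y), ∏ e ∈ y, lam e

/-- Random-cluster partition function. -/
noncomputable def Zrc (G : SimpleGraph V) [DecidableRel G.Adj] (p : Sym2 V → ℝ) : ℝ :=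
  ∑ z ∈ G.edgeFinset.powerset,
    (∏ e ∈ z, p e) * (∏ e ∈ G.edgeFinset \ z, (1 - p e)) * 2 ^ numComponents z

theorem edgeSpinProd_eq_one_or_neg_one {W : Type*} (x : W → ℤˣ) (e : Sym2 W) :
    edgeSpinProd x e = 1 ∨ edgeSpinProd x e = -1 := by
  induction e with
  | _ i j =>
    rcases Int.units_eq_one_or (x i) with hi | hi <;>
      rcases Int.units_eq_one_or (x j) with hj | hj <;> simp [edgeSpinProd, hi, hj]

theorem edgeSpinProd_eq_prod (x : V → ℤˣ) {e : Sym2 V} (he : ¬ e.IsDiag) :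
    edgeSpinProd x e = ∏ i, if i ∈ e then ((x i : ℤ) : ℝ) else 1 := by
  induction e with
  | _ i j =>
    have hij : i ≠ j := by simpa using he
    have hs : univ.filter (fun k => k ∈ s(i, j)) = {i, j} := by
      ext k
      simp
    rw [← prod_filter, hs, prod_pair hij]
    rfl

theorem exp_mul_edgeSpinProd {W : Type*} (x : W → ℤˣ) (e : Sym2 W) (b : ℝ) :
    Real.exp (b * edgeSpinProd x e) =
      Real.cosh b * (1 + Real.tanh b * edgeSpinProd x e) := by
  have h : Real.cosh b * Real.tanh b = Real.sinh b := by
    rw [Real.tanh_eq_sinh_div_cosh]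
    field_simp [(Real.cosh_pos b).ne']
  rw [mul_add, ← mul_assoc, h]
  rcases edgeSpinProd_eq_one_or_neg_one x e with hs | hs <;> rw [hs]
  · simp [Real.cosh_add_sinh]
  · simp [← sub_eq_add_neg, Real.cosh_sub_sinh]

theorem sum_intUnits_pow (n : ℕ) :
    ∑ u : ℤˣ, ((u : ℤ) : ℝ) ^ n = if Even n then 2 else 0 := by
  have hu : (univ : Finset ℤˣ) = {1, -1} := by decide
  rw [hu, sum_pair (by decide)]
  split_ifs with h
  · norm_num [h.neg_one_pow]
  · norm_num [(Nat.not_even_iff_odd.mp h).neg_one_pow]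

theorem sum_prod_edgeSpinProd (y : Finset (Sym2 V)) (hy : ∀ e ∈ y, ¬ e.IsDiag) :
    ∑ x : V → ℤˣ, ∏ e ∈ y, edgeSpinProd x e =
      if IsEvenSubgraph y then 2 ^ Fintype.card V else 0 := by
  have hx (x : V → ℤˣ) : ∏ e ∈ y, edgeSpinProd x e =
      ∏ i, ((x i : ℤ) : ℝ) ^ (y.filter (fun e => i ∈ e)).card := by
    rw [prod_congr rfl fun e he => edgeSpinProd_eq_prod x (hy e he), prod_comm]
    refine prod_congr rfl fun i _ => ?_
    rw [← prod_filter, prod_const]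
  simp_rw [hx]
  rw [← Fintype.prod_sum
    (fun i (u : ℤˣ) => ((u : ℤ) : ℝ) ^ (y.filter (fun e => i ∈ e)).card)]
  simp_rw [sum_intUnits_pow]
  split_ifs with h
  · rw [prod_congr rfl fun i _ => if_pos (h i), prod_const, card_univ]
  · obtain ⟨i, hi⟩ := not_forall.mp h
    exact prod_eq_zero (mem_univ i) (if_neg hi)

/-- `Z_spins(β) = 2^{|V|} ⬝ (∏ cosh β(e)) ⬝ Z_subs(tanh ∘ β)`. -/
theorem spins_eq_subs (G : SimpleGraph V) [DecidableRel G.Adj]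
    (β : Sym2 V → ℝ) (hβ : ∀ e ∈ G.edgeFinset, 0 ≤ β e) :
    Zspins G β =
      2 ^ (Fintype.card V) * (∏ e ∈ G.edgeFinset, Real.cosh (β e)) *
        Zsubs G (fun e => Real.tanh (β e)) := by
  unfold Zspins Zsubs
  simp_rw [exp_mul_edgeSpinProd, prod_mul_distrib, prod_one_add, prod_mul_distrib]
  rw [← mul_sum, sum_comm, mul_comm (2 ^ _), mul_assoc, sum_filter]
  congr 1
  rw [mul_sum]
  refine sum_congr rfl fun y hy => ?_
  rw [← mul_sum, sum_prod_edgeSpinProd y fun e he =>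
    G.not_isDiag_of_mem_edgeFinset (mem_powerset.mp hy he)]
  split_ifs <;> ring
end

section
/- Let G = (V,E) be a finite simple graph, let λ : E → ℝ satisfy 0 ≤ λ(e) < 1 for all e ∈ E, and let z ⊆ E. Define p(e) = 2λ(e)/(1 + λ(e)). Then Σ_{y ⊆ z, y even} (∏_{e ∈ y} λ(e)) · (∏_{e ∈ z∖y} λ(e)) · (∏_{e ∈ E∖z} (1 − λ(e))) = 2^{#C(z) − |V|} · (∏_{e ∈ E} (1 + λ(e))) · (∏_{e ∈ z} p(e)) · (∏_{e ∈ E∖z} (1 − p(e))). -/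
open Finset

variable {V : Type*} [Fintype V] [DecidableEq V]

/-- The product of a spin configuration over the endpoints of an edge. -/
def edgeSpin (σ : V → ℤˣ) (e : Sym2 V) : ℤ := ∏ v, if v ∈ e then (σ v : ℤ) else 1

lemma edgeSpin_mk (σ : V → ℤˣ) {a b : V} (hab : a ≠ b) :
    edgeSpin σ s(a, b) = (σ a : ℤ) * σ b := by
  have h : (univ.filter fun v => v ∈ s(a, b)) = {a, b} := by
    ext v; simp
  rw [edgeSpin, ← prod_filter, h, prod_pair hab]

lemma one_add_edgeSpin_mk (σ : V → ℤˣ) {a b : V} (hab : a ≠ b) :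
    1 + edgeSpin σ s(a, b) = if σ a = σ b then 2 else 0 := by
  rw [edgeSpin_mk σ hab]
  rcases Int.units_eq_one_or (σ a) with ha | ha <;>
    rcases Int.units_eq_one_or (σ b) with hb | hb <;> rw [ha, hb] <;> decide

lemma prod_edgeSpin (σ : V → ℤˣ) (y : Finset (Sym2 V)) :
    ∏ e ∈ y, edgeSpin σ e = ∏ v, (σ v : ℤ) ^ (y.filter (fun e => v ∈ e)).card := by
  simp only [edgeSpin]
  rw [prod_comm]
  refine prod_congr rfl fun v _ => ?_
  rw [← prod_filter, prod_const]

lemma sum_units_pow (d : ℕ) : ∑ ε : ℤˣ, (ε : ℤ) ^ d = if Even d then 2 else 0 := by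
  have h : (univ : Finset ℤˣ) = {1, -1} := rfl
  rw [h, sum_pair (by decide)]
  split_ifs with hd
  · simp [hd.neg_one_pow]
  · simp [(Nat.not_even_iff_odd.mp hd).neg_one_pow]

lemma sum_prod_edgeSpin (y : Finset (Sym2 V)) :
    ∑ σ : V → ℤˣ, ∏ e ∈ y, edgeSpin σ e =
      if IsEvenSubgraph y then 2 ^ Fintype.card V else 0 := by
  simp only [prod_edgeSpin]
  rw [← Fintype.prod_sum fun (v : V) (ε : ℤˣ) => (ε : ℤ) ^ (y.filter (fun e => v ∈ e)).card]
  simp only [sum_units_pow]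
  rw [prod_ite_zero, prod_const, card_univ]
  by_cases h : IsEvenSubgraph y
  · rw [if_pos h, if_pos fun v _ => h v]
  · rw [if_neg h, if_neg fun h' => h fun v => h' v (mem_univ v)]

/-- Spin configurations that are constant along the edges in `z` correspond to arbitrary spin
assignments to the connected components of `(V, z)`. -/
def constantSpinEquiv (z : Finset (Sym2 V)) :
    {σ : V → ℤˣ // ∀ a b, a ≠ b → s(a, b) ∈ z → σ a = σ b} ≃
      ((SimpleGraph.fromEdgeSet (z : Set (Sym2 V))).ConnectedComponent → ℤˣ) where
  toFun σ := SimpleGraph.ConnectedComponent.lift σ.1 fun v w p _ => by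
    induction p with
    | nil => rfl
    | cons h p ih =>
      rw [SimpleGraph.fromEdgeSet_adj] at h
      exact (σ.2 _ _ h.2 (by simpa using h.1)).trans
        (ih (by simp_all))
  invFun f := ⟨fun v => f (SimpleGraph.connectedComponentMk _ v), fun a b hab h =>
    congrArg f (SimpleGraph.ConnectedComponent.sound
      (SimpleGraph.Adj.reachable (by simpa using ⟨h, hab⟩)))⟩
  left_inv _ := rfl
  right_inv f := by
    ext c
    induction c using SimpleGraph.ConnectedComponent.ind
    rfl

lemma prod_one_add_edgeSpin (σ : V → ℤˣ) {z : Finset (Sym2 V)} (hz : ∀ e ∈ z, ¬ e.IsDiag) :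
    ∏ e ∈ z, (1 + edgeSpin σ e) =
      if ∀ a b, a ≠ b → s(a, b) ∈ z → σ a = σ b then 2 ^ z.card else 0 := by
  split_ifs with h
  · refine prod_eq_pow_card fun e he => ?_
    induction e with
    | _ a b =>
      have hab : a ≠ b := by simpa using hz _ he
      rw [one_add_edgeSpin_mk σ hab, if_pos (h a b hab he)]
  · push Not at h
    obtain ⟨a, b, hab, he, hne⟩ := h
    exact prod_eq_zero he (by rw [one_add_edgeSpin_mk σ hab, if_neg hne])

theorem card_even_subsets_mul {z : Finset (Sym2 V)} (hz : ∀ e ∈ z, ¬ e.IsDiag) :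
    (z.powerset.filter (fun y => IsEvenSubgraph y)).card * 2 ^ Fintype.card V =
      2 ^ numComponents z * 2 ^ z.card := by
  have hcard : (univ.filter fun σ : V → ℤˣ => ∀ a b, a ≠ b → s(a, b) ∈ z → σ a = σ b).card =
      2 ^ numComponents z := by
    rw [← Fintype.card_subtype, ← Nat.card_eq_fintype_card, Nat.card_congr (constantSpinEquiv z),
      Nat.card_fun, numComponents]
    simp
  have key : ∑ y ∈ z.powerset, ∑ σ : V → ℤˣ, ∏ e ∈ y, edgeSpin σ e =
      ∑ σ : V → ℤˣ, ∏ e ∈ z, (1 + edgeSpin σ e) := by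
    rw [sum_comm]
    simp only [prod_one_add]
  simp only [sum_prod_edgeSpin, prod_one_add_edgeSpin _ hz] at key
  rw [← sum_filter, ← sum_filter, sum_const, sum_const, hcard] at key
  simp only [nsmul_eq_mul] at key
  exact_mod_cast key

/-- Summing the joint subgraphs/random-cluster weight over the even
subsets `y ⊆ z` produces the random-cluster weight of `z` (up to the global constant). -/
theorem sum_even_subsets_eq_rc_weight (G : SimpleGraph V) [DecidableRel G.Adj]
    (lam : Sym2 V → ℝ) (hlam : ∀ e ∈ G.edgeFinset, 0 ≤ lam e ∧ lam e < 1)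
    (z : Finset (Sym2 V)) (hz : z ⊆ G.edgeFinset) :
    ∑ y ∈ z.powerset.filter (fun y => IsEvenSubgraph y),
        (∏ e ∈ y, lam e) * (∏ e ∈ z \ y, lam e) * (∏ e ∈ G.edgeFinset \ z, (1 - lam e)) =
      (2 : ℝ) ^ ((numComponents z : ℤ) - (Fintype.card V : ℤ)) *
        (∏ e ∈ G.edgeFinset, (1 + lam e)) *
        (∏ e ∈ z, 2 * lam e / (1 + lam e)) *
        (∏ e ∈ G.edgeFinset \ z, (1 - 2 * lam e / (1 + lam e))) := by
  have hdiag : ∀ e ∈ z, ¬ e.IsDiag := fun e he =>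
    G.not_isDiag_of_mem_edgeSet (SimpleGraph.mem_edgeFinset.mp (hz he))
  have hpos : ∀ e ∈ G.edgeFinset, 1 + lam e ≠ 0 := fun e he => by
    linarith [(hlam e he).1]
  have hcount : ((z.powerset.filter (fun y => IsEvenSubgraph y)).card : ℝ) =
      (2 : ℝ) ^ ((numComponents z : ℤ) - (Fintype.card V : ℤ)) * 2 ^ z.card := by
    rw [zpow_sub₀ two_ne_zero, zpow_natCast, zpow_natCast, div_mul_eq_mul_div,
      eq_div_iff (by positivity)]
    exact_mod_cast card_even_subsets_mul hdiag
  have hleft : ∀ y ∈ z.powerset.filter (fun y => IsEvenSubgraph y),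
      (∏ e ∈ y, lam e) * (∏ e ∈ z \ y, lam e) * (∏ e ∈ G.edgeFinset \ z, (1 - lam e)) =
        (∏ e ∈ z, lam e) * ∏ e ∈ G.edgeFinset \ z, (1 - lam e) := fun y hy => by
    rw [mul_comm (∏ e ∈ y, lam e), prod_sdiff (mem_powerset.mp (mem_filter.mp hy).1)]
  have hin : (∏ e ∈ z, (1 + lam e)) * ∏ e ∈ z, 2 * lam e / (1 + lam e) =
      2 ^ z.card * ∏ e ∈ z, lam e := by
    rw [← prod_mul_distrib, ← prod_const, ← prod_mul_distrib]
    exact prod_congr rfl fun e he => mul_div_cancel₀ _ (hpos e (hz he))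
  have hout : (∏ e ∈ G.edgeFinset \ z, (1 + lam e)) *
      ∏ e ∈ G.edgeFinset \ z, (1 - 2 * lam e / (1 + lam e)) =
        ∏ e ∈ G.edgeFinset \ z, (1 - lam e) := by
    rw [← prod_mul_distrib]
    refine prod_congr rfl fun e he => ?_
    have := hpos e (mem_sdiff.mp he).1
    field_simp
    ring
  rw [sum_congr rfl hleft, sum_const, nsmul_eq_mul, hcount, ← hout, ← prod_sdiff hz]
  linear_combination -(2 : ℝ) ^ ((numComponents z : ℤ) - (Fintype.card V : ℤ)) *
    (∏ e ∈ G.edgeFinset \ z, (1 + lam e)) *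
    (∏ e ∈ G.edgeFinset \ z, (1 - 2 * lam e / (1 + lam e))) * hin
end

section
/- Let G = (V,E) be a finite simple graph and let F_E ⊆ E be the edge set of a maximal spanning forest of G. Then the map y ↦ y ∖ F_E is a bijection from the set of even edge subsets of G onto the power set of E ∖ F_E. In particular, for each subset s ⊆ E ∖ F_E there is exactly one even y ⊆ E with y ∖ F_E = s. -/
open Finset

variable {V : Type*} [Fintype V] [DecidableEq V]

theorem isEvenSubgraph_empty : IsEvenSubgraph (∅ : Finset (Sym2 V)) := by
  intro i
  simp

theorem IsEvenSubgraph.symmDiff {y z : Finset (Sym2 V)} (hy : IsEvenSubgraph y)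
    (hz : IsEvenSubgraph z) : IsEvenSubgraph (symmDiff y z) := by
  intro i
  have key (x : Finset (Sym2 V)) :
      (x.filter (fun e => i ∈ e)).card =
        ((x \ (y ∩ z)).filter (fun e => i ∈ e)).card +
          ((x ∩ (y ∩ z)).filter (fun e => i ∈ e)).card := by
    rw [← card_union_of_disjoint, ← filter_union, sdiff_union_inter]
    exact disjoint_filter_filter (disjoint_sdiff_inter _ _)
  have hd : ((_root_.symmDiff y z).filter (fun e => i ∈ e)).card =
      ((y \ (y ∩ z)).filter (fun e => i ∈ e)).card +
        ((z \ (y ∩ z)).filter (fun e => i ∈ e)).card := by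
    rw [← card_union_of_disjoint, ← filter_union]
    · congr 2
      ext e
      simp only [mem_symmDiff, mem_union, mem_sdiff, mem_inter]
      tauto
    · refine disjoint_filter_filter (disjoint_left.2 fun e h₁ h₂ => ?_)
      simp only [mem_sdiff, mem_inter] at h₁ h₂
      tauto
  have hy' := key y
  have hz' := key z
  rw [← inter_assoc, inter_self] at hy'
  rw [inter_comm y z, ← inter_assoc, inter_self, inter_comm z y] at hz'
  have := hy i
  have := hz i
  grind

/-- An acyclic graph contains no nonempty even edge subset. -/
theorem IsEvenSubgraph.eq_empty_of_isAcyclic {F : SimpleGraph V} (hF : F.IsAcyclic)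
    {z : Finset (Sym2 V)} (hzF : (z : Set (Sym2 V)) ⊆ F.edgeSet) (hz : IsEvenSubgraph z) :
    z = ∅ := by
  classical
  by_contra hne
  obtain ⟨e, he⟩ := nonempty_iff_ne_empty.2 hne
  induction e with | _ u v
  have hb := SimpleGraph.isAcyclic_iff_forall_adj_isBridge.1 hF (hzF he)
  rw [SimpleGraph.isBridge_iff] at hb
  set S := univ.filter fun w => (F.deleteEdges {s(u, v)}).Reachable u w with hS
  have hcount := sum_card_bipartiteAbove_eq_sum_card_bipartiteBelow (s := S) (t := z)
    (fun i e => i ∈ e)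
  have hl : Even (∑ i ∈ S, (z.bipartiteAbove (fun i e => i ∈ e) i).card) :=
    even_sum _ fun i _ => hz i
  rw [hcount, ← add_sum_erase _ _ he] at hl
  have hr : Even (∑ e ∈ z.erase s(u, v), (S.bipartiteBelow (fun i e => i ∈ e) e).card) := by
    refine even_sum _ fun e' he' => ?_
    obtain ⟨hne', he'⟩ := mem_erase.1 he'
    induction e' with | _ a b
    have hab : F.Adj a b := hzF he'
    have hadj : (F.deleteEdges {s(u, v)}).Adj a b := by
      rw [SimpleGraph.deleteEdges_adj]
      exact ⟨hab, hne'⟩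
    have hiff : a ∈ S ↔ b ∈ S := by
      simp only [hS, mem_filter, mem_univ, true_and]
      exact ⟨fun h => h.trans hadj.reachable, fun h => h.trans hadj.symm.reachable⟩
    by_cases ha : a ∈ S
    · have : S.bipartiteBelow (fun i e => i ∈ e) s(a, b) = {a, b} := by
        ext w
        simp only [mem_bipartiteBelow, Sym2.mem_iff, mem_insert, mem_singleton]
        grind
      rw [this, card_pair hab.ne]
      exact even_two
    · have : S.bipartiteBelow (fun i e => i ∈ e) s(a, b) = ∅ := by
        ext w
        simp only [mem_bipartiteBelow, Sym2.mem_iff, notMem_empty, iff_false]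
        grind
      simp [this]
  have hone : S.bipartiteBelow (fun i e => i ∈ e) s(u, v) = {u} := by
    have hu : u ∈ S := by simp [hS]
    have hv : v ∉ S := by simpa [hS] using hb
    ext w
    simp only [mem_bipartiteBelow, Sym2.mem_iff, mem_singleton]
    grind
  rw [hone, card_singleton, Nat.even_add] at hl
  exact Nat.not_even_one (hl.2 hr)

theorem SimpleGraph.Walk.IsTrail.isEvenSubgraph_edges {G : SimpleGraph V} {u : V} {p : G.Walk u u}
    (hp : p.IsTrail) : IsEvenSubgraph p.edges.toFinset := by
  intro i
  have : p.edges.toFinset.filter (fun e => i ∈ e) =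
      (p.edges.filter fun e => i ∈ e).toFinset := by
    simp [List.toFinset_filter]
  rw [this, List.toFinset_card_of_nodup (hp.edges_nodup.filter _), ← List.countP_eq_length_filter]
  exact (hp.even_countP_edges_iff i).2 fun h => absurd rfl h

/-- A non-edge of `F` joining two vertices connected in `F` lies in an even edge subset, all of
whose other edges are in `F`. -/
theorem exists_isEvenSubgraph_sdiff_eq_singleton {F : SimpleGraph V} [DecidableRel F.Adj]
    {u v : V} (huv : u ≠ v) (hnF : ¬F.Adj u v) (hr : F.Reachable u v) :
    ∃ c : Finset (Sym2 V), IsEvenSubgraph c ∧ c \ F.edgeFinset = {s(u, v)} := by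
  obtain ⟨p, hp⟩ := hr.symm.exists_isPath
  have hle : F ≤ F ⊔ SimpleGraph.edge u v := le_sup_left
  have hadj : (F ⊔ SimpleGraph.edge u v).Adj u v := by simp [SimpleGraph.edge_adj, huv]
  have hmem : s(u, v) ∉ p.edges := fun h => hnF (p.edges_subset_edgeSet h)
  have ht : (SimpleGraph.Walk.cons hadj (p.mapLe hle)).IsTrail := by
    rw [SimpleGraph.Walk.isTrail_cons]
    exact ⟨hp.isTrail.mapLe hle, by simpa using hmem⟩
  refine ⟨_, ht.isEvenSubgraph_edges, ?_⟩
  ext e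
  have : e ∈ p.edges → e ∈ F.edgeSet := fun h => p.edges_subset_edgeSet h
  simp only [SimpleGraph.Walk.edges_cons, SimpleGraph.Walk.edges_mapLe_eq_edges,
    List.toFinset_cons, mem_sdiff, mem_insert, List.mem_toFinset, SimpleGraph.mem_edgeFinset,
    mem_singleton]
  constructor
  · tauto
  · rintro rfl
    exact ⟨Or.inl rfl, hnF⟩

theorem exists_isEvenSubgraph_sdiff_eq {F : SimpleGraph V} [DecidableRel F.Adj]
    (s : Finset (Sym2 V))
    (hs : ∀ u v, s(u, v) ∈ s → u ≠ v ∧ ¬F.Adj u v ∧ F.Reachable u v) :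
    ∃ y : Finset (Sym2 V), IsEvenSubgraph y ∧ y \ F.edgeFinset = s := by
  induction s using Finset.induction_on with
  | empty => exact ⟨∅, isEvenSubgraph_empty, empty_sdiff _⟩
  | insert e s he ih =>
    obtain ⟨y, hy, rfl⟩ := ih fun u v h => hs u v (mem_insert_of_mem h)
    induction e with | _ u v
    obtain ⟨huv, hnF, hr⟩ := hs u v (mem_insert_self _ _)
    obtain ⟨c, hc, hcF⟩ := exists_isEvenSubgraph_sdiff_eq_singleton huv hnF hr
    refine ⟨symmDiff y c, hy.symmDiff hc, ?_⟩
    ext e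
    have := Finset.ext_iff.1 hcF e
    simp only [mem_sdiff, mem_singleton, mem_symmDiff, mem_insert] at this he ⊢
    grind

/-- If `F` is a maximal spanning forest of `G`, then `y ↦ y \ F_E`
is a bijection from the even edge subsets of `G` onto the subsets of `E \ F_E`. -/
theorem even_subsets_bij_spanning_forest (G : SimpleGraph V) [DecidableRel G.Adj]
    (F : SimpleGraph V) [DecidableRel F.Adj]
    (hFG : F ≤ G) (hF : F.IsAcyclic)
    (hmax : ∀ F' : SimpleGraph V, F ≤ F' → F' ≤ G → F'.IsAcyclic → F' = F) :
    Set.BijOn (fun y => y \ F.edgeFinset)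
      {y : Finset (Sym2 V) | y ⊆ G.edgeFinset ∧ IsEvenSubgraph y}
      {s : Finset (Sym2 V) | s ⊆ G.edgeFinset \ F.edgeFinset} ∧
    (∀ s ⊆ G.edgeFinset \ F.edgeFinset,
      ∃! y : Finset (Sym2 V),
        y ⊆ G.edgeFinset ∧ IsEvenSubgraph y ∧ y \ F.edgeFinset = s) := by
  have hreach : F.Reachable = G.Reachable := by
    rw [← SimpleGraph.maximal_isAcyclic_iff_reachable_eq hFG hF]
    exact ⟨⟨hFG, hF⟩, fun F' h hle => (hmax F' hle h.1 h.2).le⟩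
  have hinj (y z : Finset (Sym2 V)) (hy : IsEvenSubgraph y) (hz : IsEvenSubgraph z)
      (h : y \ F.edgeFinset = z \ F.edgeFinset) : y = z := by
    refine symmDiff_eq_bot.1 ((hy.symmDiff hz).eq_empty_of_isAcyclic hF fun e he => ?_)
    have := Finset.ext_iff.1 h e
    rw [mem_coe, mem_symmDiff] at he
    simp only [mem_sdiff, SimpleGraph.mem_edgeFinset] at this
    tauto
  have hsurj (s : Finset (Sym2 V)) (hs : s ⊆ G.edgeFinset \ F.edgeFinset) :
      ∃ y ⊆ G.edgeFinset, IsEvenSubgraph y ∧ y \ F.edgeFinset = s := by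
    obtain ⟨y, hy, rfl⟩ := exists_isEvenSubgraph_sdiff_eq (F := F) s fun u v h => by
      have h' := hs h
      rw [mem_sdiff, SimpleGraph.mem_edgeFinset, SimpleGraph.mem_edgeFinset] at h'
      have hG : G.Adj u v := h'.1
      exact ⟨hG.ne, h'.2, hreach ▸ hG.reachable⟩
    refine ⟨y, fun e he => ?_, hy, rfl⟩
    by_cases heF : e ∈ F.edgeFinset
    · exact SimpleGraph.edgeFinset_mono hFG heF
    · exact (mem_sdiff.1 (hs (mem_sdiff.2 ⟨he, heF⟩))).1
  refine ⟨⟨fun y hy => sdiff_subset_sdiff hy.1 le_rfl, fun y hy z hz h => hinj y z hy.2 hz.2 h,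
    fun s hs => ?_⟩, fun s hs => ?_⟩
  · obtain ⟨y, hyG, hy, hys⟩ := hsurj s hs
    exact ⟨y, ⟨hyG, hy⟩, hys⟩
  · obtain ⟨y, hyG, hy, hys⟩ := hsurj s hs
    exact ⟨y, ⟨hyG, hy, hys⟩, fun z hz => hinj z y hz.2.1 hy (hz.2.2.trans hys.symm)⟩
end

section
/- Let G = (V,E) be a finite simple graph, let β : E → ℝ satisfy β(e) ≥ 0 for all e ∈ E, and define p(e) = 1 − exp(−2β(e)). For a spin configuration x : V → {−1,1}, let S(x) = {z ⊆ E : for every edge {i,j} ∈ z, x(i) = x(j)} be the set of edge subsets consistent with x. Then Σ_{z ∈ S(x)} (∏_{e ∈ z} p(e)) · (∏_{e ∈ E∖z} (1 − p(e))) = ∏_{{i,j} ∈ E} exp(β({i,j})·(x(i)·x(j) − 1)). -/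
open Finset

variable {V : Type*} [Fintype V] [DecidableEq V]

/-- The two endpoint spins of an edge agree. -/
def spinsAgree (x : V → ℤˣ) : Sym2 V → Prop :=
  Sym2.lift ⟨fun i j => x i = x j, fun _ _ => propext ⟨Eq.symm, Eq.symm⟩⟩

attribute [local instance] Classical.propDecidable

/-- Summing the product weights over the subsets of `s` all of whose elements satisfy `P`
replaces the factor `f e` by `0` wherever `P e` fails. -/
theorem sum_powerset_filter_forall_mul_prod_sdiff {ι R : Type*} [DecidableEq ι]
    [CommSemiring R] (s : Finset ι) (P : ι → Prop) [DecidablePred P]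
    [DecidablePred fun z : Finset ι => ∀ e ∈ z, P e] (f g : ι → R) :
    ∑ z ∈ s.powerset.filter (fun z => ∀ e ∈ z, P e), (∏ e ∈ z, f e) * ∏ e ∈ s \ z, g e =
      ∏ e ∈ s, ((if P e then f e else 0) + g e) := by
  rw [Finset.prod_add, Finset.sum_filter]
  refine Finset.sum_congr rfl fun z _ => ?_
  rw [Finset.prod_ite_zero, ite_mul, zero_mul]
  congr

/-- The product of the endpoint spins is `1` if they agree and `-1` otherwise. -/
theorem edgeSpinProd_eq_ite {V : Type*} (x : V → ℤˣ) (e : Sym2 V) :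
    edgeSpinProd x e = if spinsAgree x e then 1 else -1 := by
  induction e with
  | _ i j =>
    simp only [edgeSpinProd, spinsAgree, Sym2.lift_mk]
    rcases Int.units_eq_one_or (x i) with hi | hi <;>
      rcases Int.units_eq_one_or (x j) with hj | hj <;> simp [hi, hj]

/-- Summing the random-cluster edge weights over the edge subsets
consistent with a spin configuration `x` gives `∏_{{i,j} ∈ E} exp(β(e)·(x(i)x(j) - 1))`. -/
theorem sum_consistent_rc_weights (G : SimpleGraph V) [DecidableRel G.Adj]
    (β : Sym2 V → ℝ) (hβ : ∀ e ∈ G.edgeFinset, 0 ≤ β e)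
    (p : Sym2 V → ℝ) (hp : ∀ e, p e = 1 - Real.exp (-2 * β e))
    (x : V → ℤˣ) :
    ∑ z ∈ G.edgeFinset.powerset.filter (fun z => ∀ e ∈ z, spinsAgree x e),
        (∏ e ∈ z, p e) * (∏ e ∈ G.edgeFinset \ z, (1 - p e)) =
      ∏ e ∈ G.edgeFinset, Real.exp (β e * (edgeSpinProd x e - 1)) := by
  rw [sum_powerset_filter_forall_mul_prod_sdiff]
  refine Finset.prod_congr rfl fun e _ => ?_
  rw [edgeSpinProd_eq_ite, hp]
  split_ifs
  · simp
  · ring_nf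
end

section
/- Let G = (V,E) be a finite simple graph, let β : E → ℝ satisfy β(e) ≥ 0 for all e ∈ E, and define p(e) = 1 − exp(−2β(e)). For a spin configuration x : V → {−1,1}, let S(x) = {z ⊆ E : for every edge {i,j} ∈ z, x(i) = x(j)}. Then for every x : V → {−1,1}, (1/Z_rc(p)) · Σ_{z ∈ S(x)} (∏_{e ∈ z} p(e)) · (∏_{e ∈ E∖z} (1 − p(e))) · 2^{#C(z)} · 2^{−#C(z)} = (1/Z_spins(β)) · ∏_{{i,j} ∈ E} exp(β({i,j})·x(i)·x(j)). That is, drawing z from the random cluster distribution and then assigning each connected component of (V,z) a uniform independent spin produces a spin configuration distributed according to the spins distribution w_spins(x)/Z_spins(β). -/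
open Finset

variable {V : Type*} [Fintype V] [DecidableEq V]

theorem sum_filter_powerset_prod_mul_prod_sdiff {ι R : Type*} [CommRing R] [DecidableEq ι]
    (E : Finset ι) (p : ι → R) (A : ι → Prop) [DecidablePred A]
    [DecidablePred fun z : Finset ι => ∀ e ∈ z, A e] :
    ∑ z ∈ E.powerset.filter (fun z => ∀ e ∈ z, A e), (∏ e ∈ z, p e) * ∏ e ∈ E \ z, (1 - p e) =
      ∏ e ∈ E, if A e then 1 else 1 - p e := by
  have h : ∀ e ∈ E, (if A e then 1 else 1 - p e) = (if A e then p e else 0) + (1 - p e) := by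
    intro e _
    split_ifs <;> ring
  rw [Finset.prod_congr rfl h, Finset.prod_add, Finset.sum_filter]
  refine Finset.sum_congr rfl fun z _ => ?_
  split_ifs with hz
  · congr 1
    exact Finset.prod_congr rfl fun e he => by rw [if_pos (hz e he)]
  · push Not at hz
    obtain ⟨e, he, hne⟩ := hz
    rw [Finset.prod_eq_zero he (if_neg hne), zero_mul]

theorem exp_mul_edgeSpinProd_s12 (b : ℝ) (x : V → ℤˣ) (e : Sym2 V) [Decidable (spinsAgree x e)] :
    Real.exp (b * edgeSpinProd x e) =
      Real.exp b * if spinsAgree x e then 1 else Real.exp (-2 * b) := by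
  have h : spinsAgree x e ∧ edgeSpinProd x e = 1 ∨ ¬ spinsAgree x e ∧ edgeSpinProd x e = -1 := by
    induction e with
    | h i j =>
      change x i = x j ∧ ((x i : ℤ) : ℝ) * ((x j : ℤ) : ℝ) = 1 ∨
        ¬ x i = x j ∧ ((x i : ℤ) : ℝ) * ((x j : ℤ) : ℝ) = -1
      rcases Int.units_eq_one_or (x i) with hi | hi <;>
        rcases Int.units_eq_one_or (x j) with hj | hj <;> simp [hi, hj]
  rcases h with ⟨hA, hP⟩ | ⟨hA, hP⟩
  · simp [hA, hP]
  · rw [hP, if_neg hA, ← Real.exp_add]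
    ring_nf

/-- Spin configurations agreeing along every edge of `z` are the functions on the connected
components of `(V, z)`. -/
theorem card_filter_forall_spinsAgree (z : Finset (Sym2 V))
    [DecidablePred fun x : V → ℤˣ => ∀ e ∈ z, spinsAgree x e] :
    (univ.filter fun x : V → ℤˣ => ∀ e ∈ z, spinsAgree x e).card = 2 ^ numComponents z := by
  classical
  set H := SimpleGraph.fromEdgeSet (z : Set (Sym2 V)) with hH
  have hinj : Function.Injective
      fun (c : H.ConnectedComponent → ℤˣ) (v : V) => c (H.connectedComponentMk v) := by
    intro c d hcd
    funext k
    induction k using SimpleGraph.ConnectedComponent.ind with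
    | _ v => exact congrFun hcd v
  have himg : (univ.filter fun x : V → ℤˣ => ∀ e ∈ z, spinsAgree x e) =
      univ.image fun (c : H.ConnectedComponent → ℤˣ) (v : V) => c (H.connectedComponentMk v) := by
    ext x
    simp only [mem_filter, mem_univ, true_and, mem_image]
    constructor
    · intro hx
      have hadj : ∀ v w, H.Adj v w → x v = x w := fun v w h =>
        hx s(v, w) (by simpa using ((SimpleGraph.fromEdgeSet_adj _).1 h).1)
      have hwalk : ∀ v w (q : H.Walk v w), x v = x w := by
        intro v w q
        induction q with
        | nil => rfl
        | cons h _ ih => exact (hadj _ _ h).trans ih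
      exact ⟨fun k => k.lift x fun v w q _ => hwalk v w q, rfl⟩
    · rintro ⟨c, rfl⟩ e he
      induction e with
      | h i j =>
        change c _ = c _
        by_cases hij : i = j
        · rw [hij]
        · have hadj : H.Adj i j := (SimpleGraph.fromEdgeSet_adj _).2 ⟨by simpa using he, hij⟩
          rw [SimpleGraph.ConnectedComponent.sound hadj.reachable]
  rw [himg, Finset.card_image_of_injective _ hinj, Finset.card_univ, Fintype.card_fun,
    Fintype.card_units_int, numComponents, Nat.card_eq_fintype_card]

theorem sum_prod_ite_spinsAgree_eq_Zrc (G : SimpleGraph V) [DecidableRel G.Adj] (p : Sym2 V → ℝ)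
    [∀ x : V → ℤˣ, DecidablePred (spinsAgree x)] :
    ∑ x : V → ℤˣ, ∏ e ∈ G.edgeFinset, (if spinsAgree x e then 1 else 1 - p e) = Zrc G p := by
  classical
  simp_rw [← sum_filter_powerset_prod_mul_prod_sdiff, Finset.sum_filter]
  rw [Finset.sum_comm, Zrc]
  refine Finset.sum_congr rfl fun z _ => ?_
  rw [← Finset.sum_filter, Finset.sum_const, card_filter_forall_spinsAgree, nsmul_eq_mul, mul_comm]
  push_cast
  congr!

attribute [local instance] Classical.propDecidable

/-- Drawing `z` from the random-cluster distribution and then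
assigning each of the `#C(z)` clusters a uniform spin (probability `2^{-#C(z)}` for
each consistent assignment) produces a spin configuration distributed as
`w_spins(x)/Z_spins(β)`. -/
theorem rc_plus_uniform_spins_eq_spins (G : SimpleGraph V) [DecidableRel G.Adj]
    (β : Sym2 V → ℝ) (hβ : ∀ e ∈ G.edgeFinset, 0 ≤ β e)
    (p : Sym2 V → ℝ) (hp : ∀ e, p e = 1 - Real.exp (-2 * β e)) :
    ∀ x : V → ℤˣ,
      (1 / Zrc G p) *
        ∑ z ∈ G.edgeFinset.powerset.filter (fun z => ∀ e ∈ z, spinsAgree x e),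
          (∏ e ∈ z, p e) * (∏ e ∈ G.edgeFinset \ z, (1 - p e)) *
            2 ^ numComponents z * (2 : ℝ) ^ (-(numComponents z : ℤ)) =
      (1 / Zspins G β) * ∏ e ∈ G.edgeFinset, Real.exp (β e * edgeSpinProd x e) := by
  intro x
  have hp' : ∀ e, 1 - p e = Real.exp (-2 * β e) := fun e => by rw [hp e]; ring
  have hw : ∀ x : V → ℤˣ, ∏ e ∈ G.edgeFinset, Real.exp (β e * edgeSpinProd x e) =
      (∏ e ∈ G.edgeFinset, Real.exp (β e)) *
        ∏ e ∈ G.edgeFinset, if spinsAgree x e then 1 else 1 - p e := by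
    intro x
    simp_rw [exp_mul_edgeSpinProd_s12, Finset.prod_mul_distrib, hp']
  have hZ : Zspins G β = (∏ e ∈ G.edgeFinset, Real.exp (β e)) * Zrc G p := by
    rw [← sum_prod_ite_spinsAgree_eq_Zrc, Finset.mul_sum, Zspins]
    refine Finset.sum_congr rfl fun x _ => ?_
    convert hw x
  have hC : ∏ e ∈ G.edgeFinset, Real.exp (β e) ≠ 0 :=
    Finset.prod_ne_zero_iff.2 fun e _ => Real.exp_ne_zero _
  have hpow : ∀ n : ℕ, (2 : ℝ) ^ n * 2 ^ (-(n : ℤ)) = 1 := fun n => by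
    rw [zpow_neg, zpow_natCast, mul_inv_cancel₀ (by positivity)]
  simp_rw [mul_assoc _ ((2 : ℝ) ^ numComponents _), hpow, mul_one]
  rw [sum_filter_powerset_prod_mul_prod_sdiff, hw, hZ, one_div_mul_eq_div, one_div_mul_eq_div,
    mul_div_mul_left _ _ hC]
end
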